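/- Let A ∈ Λ²V* ⊗ End(V) be totally trace-free and satisfy the algebraic Bianchi identity, and let P ∈ V* ⊗ V* be symmetric. Define the curvature-type tensor R(x,y) = A(x,y) + x ⊗ P(y,·) − y ⊗ P(x,·) (i.e., R_{ab}{}^c{}_d = A_{ab}{}^c{}_d + δ_a^c P_{bd} − δ_b^c P_{ad}). Then for every k ≥ 1, the fully antisymmetrized trace form (x₁,…,x_{2k}) ↦ Σ_σ (−1)^σ tr(R(x_{σ(1)},x_{σ(2)}) ∘ ⋯ ∘ R(x_{σ(2k−1)},x_{σ(2k)})) equals the same expression with R replaced by A throughout; that is, the Chern-type forms of R depend only on the Weyl part A. -/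

import Mathlib

open Finset

/-- The `k`-th Chern-type curvature form (full antisymmetrization of the trace of a
`k`-fold composition). -/
noncomputable def chernForm {V : Type*} [AddCommGroup V] [Module ℝ V]
    (k : ℕ) (R : V → V → Module.End ℝ V) (x : Fin (2 * k) → V) : ℝ :=
  ∑ σ : Equiv.Perm (Fin (2 * k)), ((Equiv.Perm.sign σ : ℤ) : ℝ) *
    LinearMap.trace ℝ V
      ((List.ofFn fun i : Fin k =>
        R (x (σ ⟨2 * i, by have := i.isLt; omega⟩))
          (x (σ ⟨2 * i + 1, by have := i.isLt; omega⟩))).prod)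

lemma stmt14_cyc {n : ℕ} (g : Equiv.Perm (Fin n) → ℝ) (τ : Equiv.Perm (Fin n))
    (hτ : Equiv.Perm.sign τ = 1) (hg : ∀ σ, g σ + g (σ * τ) + g (σ * τ * τ) = 0) :
    ∑ σ : Equiv.Perm (Fin n), ((Equiv.Perm.sign σ : ℤ) : ℝ) * g σ = 0 := by
  have shift : ∀ f : Equiv.Perm (Fin n) → ℝ,
      ∑ σ : Equiv.Perm (Fin n), ((Equiv.Perm.sign σ : ℤ) : ℝ) * f (σ * τ) =
      ∑ σ : Equiv.Perm (Fin n), ((Equiv.Perm.sign σ : ℤ) : ℝ) * f σ := by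
    intro f
    refine Fintype.sum_equiv (Equiv.mulRight τ) _ _ ?_
    intro σ
    simp [hτ]
  have h1 := shift g
  have h2 := shift (fun σ => g (σ * τ))
  have h3 : ∑ σ : Equiv.Perm (Fin n), ((Equiv.Perm.sign σ : ℤ) : ℝ) *
      (g σ + g (σ * τ) + g (σ * τ * τ)) = 0 := by
    simp [hg]
  simp only [mul_add, Finset.sum_add_distrib] at h3
  linarith

lemma stmt14_half {V : Type*} [AddCommGroup V] [Module ℝ V]
    {n : ℕ} (x : Fin n → V) (a b c d : Fin n)
    (hab : a ≠ b) (hac : a ≠ c) (had : a ≠ d) (hbc : b ≠ c) (hbd : b ≠ d) (hcd : c ≠ d)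
    (B : V → V → Module.End ℝ V) (hB : ∀ x y z : V, B x y z + B y z x + B z x y = 0)
    (P : V →ₗ[ℝ] V →ₗ[ℝ] ℝ)
    (X : Equiv.Perm (Fin n) → Module.End ℝ V)
    (hX : ∀ σ τ : Equiv.Perm (Fin n),
      (∀ i, i ≠ a → i ≠ b → i ≠ c → i ≠ d → τ i = i) → X (σ * τ) = X σ) :
    ∑ σ : Equiv.Perm (Fin n), ((Equiv.Perm.sign σ : ℤ) : ℝ) *
      LinearMap.trace ℝ V (B (x (σ a)) (x (σ b)) *
        ((P (x (σ d))).smulRight (x (σ c)) * X σ)) = 0 := by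
  let τ : Equiv.Perm (Fin n) := Equiv.swap a b * Equiv.swap b c
  have ta : τ a = b := by
    simp [τ, Equiv.swap_apply_of_ne_of_ne hab hac]
  have tb : τ b = c := by
    simp [τ, Equiv.swap_apply_of_ne_of_ne hac.symm hbc.symm]
  have tc : τ c = a := by simp [τ]
  have tfix : ∀ i, i ≠ a → i ≠ b → i ≠ c → τ i = i := by
    intro i h1 h2 h3
    simp [τ, Equiv.swap_apply_of_ne_of_ne h2 h3, Equiv.swap_apply_of_ne_of_ne h1 h2]
  have td : τ d = d := tfix d had.symm hbd.symm hcd.symm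
  refine stmt14_cyc _ τ ?_ ?_
  · simp [τ, Equiv.Perm.sign_mul, Equiv.Perm.sign_swap hab, Equiv.Perm.sign_swap hbc]
  · intro σ
    have hx : ∀ σ, X (σ * τ) = X σ := fun σ => hX σ τ (fun i h1 h2 h3 _ => tfix i h1 h2 h3)
    simp only [hx, Equiv.Perm.mul_apply, ta, tb, tc, td]
    rw [← map_add, ← map_add]
    convert map_zero (LinearMap.trace ℝ V) using 2
    ext v
    have := hB (x (σ a)) (x (σ b)) (x (σ c))
    simp only [LinearMap.add_apply, Module.End.mul_apply, LinearMap.smulRight_apply, map_smul,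
      ← smul_add, this, smul_zero, LinearMap.zero_apply]

lemma stmt14_trace_rotate {V : Type*} [AddCommGroup V] [Module ℝ V] {m : ℕ}
    (f : Fin (m + 1) → Module.End ℝ V) (c : Fin (m + 1)) :
    LinearMap.trace ℝ V (List.ofFn f).prod =
      LinearMap.trace ℝ V (List.ofFn fun i => f (i + c)).prod := by
  have h : (List.ofFn fun i => f (i + c)) = (List.ofFn f).rotate c := by
    apply List.ext_getElem
    · simp
    · intro i h1 h2
      simp only [List.getElem_ofFn, List.getElem_rotate, List.length_ofFn]
      congr 1
  rw [h, List.rotate_eq_drop_append_take (by simp [c.isLt.le]), List.prod_append,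
    LinearMap.trace_mul_comm, ← List.prod_append, List.take_append_drop]

lemma stmt14_key {V : Type*} [AddCommGroup V] [Module ℝ V] [FiniteDimensional ℝ V]
    (P : V →ₗ[ℝ] V →ₗ[ℝ] ℝ) (hPsymm : ∀ x y : V, P x y = P y x)
    (k : ℕ) (x : Fin (2 * k) → V) (B : Fin k → V → V → Module.End ℝ V)
    (hB : ∀ i, ∀ x y z : V, B i x y z + B i y z x + B i z x y = 0) (j : Fin k)
    (hj : B j = fun a b => (P b).smulRight a - (P a).smulRight b) :
    ∑ σ : Equiv.Perm (Fin (2 * k)), ((Equiv.Perm.sign σ : ℤ) : ℝ) *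
      LinearMap.trace ℝ V
      ((List.ofFn fun i : Fin k =>
        B i (x (σ ⟨2 * i, by have := i.isLt; omega⟩))
          (x (σ ⟨2 * i + 1, by have := i.isLt; omega⟩))).prod) = 0 := by
  match k, x, B, hB, j, hj with
  | 0, _, _, _, j, _ => exact j.elim0
  | 1, x, B, hB, j, hj =>
    obtain rfl : j = 0 := Subsingleton.elim _ _
    apply Finset.sum_eq_zero
    intro σ _
    simp [hj, LinearMap.trace_smulRight, hPsymm]
  | m + 2, x, B, hB, j, hj =>
    let c : Fin (m + 2) := j - 1
    have e1 : (1 : Fin (m + 2)) + c = j := by simp [c]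
    let p : Fin (m + 2) → Fin (2 * (m + 2)) := fun i => ⟨2 * i, by have := i.isLt; omega⟩
    let q : Fin (m + 2) → Fin (2 * (m + 2)) := fun i => ⟨2 * i + 1, by have := i.isLt; omega⟩
    have pp : ∀ i i', p i = p i' → i = i' := by
      intro i i' h
      simp only [p, Fin.mk.injEq] at h
      apply Fin.ext; omega
    have qq : ∀ i i', q i = q i' → i = i' := by
      intro i i' h
      simp only [q, Fin.mk.injEq] at h
      apply Fin.ext; omega
    have pq : ∀ i i', p i ≠ q i' := by
      intro i i' h
      simp only [p, q, Fin.mk.injEq] at h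
      omega
    have hcj : c ≠ j := by
      intro h
      rw [← e1] at h
      simp at h
    let X : Equiv.Perm (Fin (2 * (m + 2))) → Module.End ℝ V := fun σ =>
      (List.ofFn fun i : Fin m => B (i.succ.succ + c) (x (σ (p (i.succ.succ + c))))
        (x (σ (q (i.succ.succ + c))))).prod
    have hX : ∀ σ τ : Equiv.Perm (Fin (2 * (m + 2))),
        (∀ i, i ≠ p c → i ≠ q c → i ≠ p j → i ≠ q j → τ i = i) → X (σ * τ) = X σ := by
      intro σ τ h
      have n1 : ∀ i : Fin m, i.succ.succ + c ≠ c := by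
        intro i hi
        have : i.succ.succ = 0 := by simpa using hi
        exact Fin.succ_ne_zero _ this
      have n2 : ∀ i : Fin m, i.succ.succ + c ≠ j := by
        intro i hi
        rw [← e1] at hi
        have := add_right_cancel hi
        rw [← Fin.succ_zero_eq_one] at this
        exact Fin.succ_ne_zero _ (Fin.succ_injective _ this)
      have hp : ∀ i : Fin m, τ (p (i.succ.succ + c)) = p (i.succ.succ + c) := fun i =>
        h _ (fun h => n1 i (pp _ _ h)) (pq _ _) (fun h => n2 i (pp _ _ h)) (pq _ _)
      have hq : ∀ i : Fin m, τ (q (i.succ.succ + c)) = q (i.succ.succ + c) := fun i =>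
        h _ (pq _ _).symm (fun h => n1 i (qq _ _ h)) (pq _ _).symm (fun h => n2 i (qq _ _ h))
      simp only [X, Equiv.Perm.mul_apply, hp, hq]
    have h1 := stmt14_half x (p c) (q c) (p j) (q j) (pq _ _) (fun h => hcj (pp _ _ h)) (pq _ _)
      (pq _ _).symm (fun h => hcj (qq _ _ h)) (pq _ _) (B c) (hB c) P X hX
    have h2 := stmt14_half x (p c) (q c) (q j) (p j) (pq _ _) (pq _ _) (fun h => hcj (pp _ _ h))
      (fun h => hcj (qq _ _ h)) (pq _ _).symm (pq _ _).symm (B c) (hB c) P X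
      (fun σ τ h => hX σ τ (fun i a b c d => h i a b d c))
    have h3 := congrArg₂ (· - ·) h1 h2
    simp only [← Finset.sum_sub_distrib, sub_zero] at h3
    rw [← h3]
    refine Finset.sum_congr rfl fun σ _ => ?_
    rw [← mul_sub, ← map_sub, ← mul_sub, ← sub_mul]
    congr 1
    change LinearMap.trace ℝ V (List.ofFn fun i => B i (x (σ (p i))) (x (σ (q i)))).prod = _
    rw [stmt14_trace_rotate _ c, List.ofFn_succ, List.ofFn_succ, List.prod_cons, List.prod_cons,
      zero_add, Fin.succ_zero_eq_one, e1]
    simp only [hj]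
    rfl

/-- If `A` is a totally trace-free algebraic Weyl-type tensor satisfying the
algebraic Bianchi identity, and `P` is symmetric, then the Chern-type forms of
`R(x,y) = A(x,y) + x ⊗ P(y,·) − y ⊗ P(x,·)` coincide with those of `A`:
they depend only on the Weyl part. -/
theorem stmt14 {V : Type*} [AddCommGroup V] [Module ℝ V] [FiniteDimensional ℝ V]
    (A : V →ₗ[ℝ] V →ₗ[ℝ] Module.End ℝ V)
    (hAalt : ∀ x y : V, A x y = - A y x)
    (hbianchi : ∀ x y z : V, A x y z + A y z x + A z x y = 0)
    -- total trace-freeness: both contractions of `A` vanish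
    (htr1 : ∀ x y : V, LinearMap.trace ℝ V (A x y) = 0)
    (htr2 : ∀ x y : V, LinearMap.trace ℝ V ((A x).flip y) = 0)
    (P : V →ₗ[ℝ] V →ₗ[ℝ] ℝ)
    (hPsymm : ∀ x y : V, P x y = P y x) :
    ∀ k : ℕ, 1 ≤ k → ∀ x : Fin (2 * k) → V,
      chernForm k
        (fun a b => A a b + (P b).smulRight a - (P a).smulRight b) x =
      chernForm k (fun a b => A a b) x := by
  intro k hk x
  let Q : V → V → Module.End ℝ V := fun a b => (P b).smulRight a - (P a).smulRight b
  have hQ : ∀ x y z : V, Q x y z + Q y z x + Q z x y = 0 := by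
    intro x y z
    simp only [Q, LinearMap.sub_apply, LinearMap.smulRight_apply]
    rw [hPsymm y x, hPsymm z x, hPsymm z y]
    abel
  let B : Finset (Fin k) → Fin k → V → V → Module.End ℝ V := fun s i =>
    if i ∈ s then (fun a b => A a b) else Q
  have hB : ∀ s i, ∀ x y z : V, B s i x y z + B s i y z x + B s i z x y = 0 := by
    intro s i x y z
    by_cases h : i ∈ s
    · simp only [B, if_pos h]; exact hbianchi x y z
    · simp only [B, if_neg h]; exact hQ x y z
  let G : Finset (Fin k) → ℝ := fun s =>
    ∑ σ : Equiv.Perm (Fin (2 * k)), ((Equiv.Perm.sign σ : ℤ) : ℝ) *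
      LinearMap.trace ℝ V
      ((List.ofFn fun i : Fin k =>
        B s i (x (σ ⟨2 * i, by have := i.isLt; omega⟩))
          (x (σ ⟨2 * i + 1, by have := i.isLt; omega⟩))).prod)
  have h0 : ∀ s, s ≠ Finset.univ → G s = 0 := by
    intro s hs
    obtain ⟨j, hj⟩ : ∃ j, j ∉ s := by
      by_contra! h
      exact hs (Finset.eq_univ_iff_forall.mpr h)
    exact stmt14_key P hPsymm k x (B s) (hB s) j (by simp only [B, if_neg hj]; rfl)
  have h1 : chernForm k (fun a b => A a b) x = G Finset.univ := by
    simp only [chernForm, G, B, Finset.mem_univ, if_true]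
  rw [h1, ← Finset.sum_eq_single_of_mem (f := G) Finset.univ (Finset.mem_univ _)
    (fun s _ hs => h0 s hs)]
  simp only [G, chernForm]
  rw [Finset.sum_comm]
  refine Finset.sum_congr rfl fun σ _ => ?_
  rw [← Finset.mul_sum, ← map_sum]
  congr 2
  have := (MultilinearMap.mkPiAlgebraFin ℝ k (Module.End ℝ V)).map_add_univ
    (fun i : Fin k => A (x (σ ⟨2 * i, by have := i.isLt; omega⟩))
          (x (σ ⟨2 * i + 1, by have := i.isLt; omega⟩)))
    (fun i : Fin k => Q (x (σ ⟨2 * i, by have := i.isLt; omega⟩))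
          (x (σ ⟨2 * i + 1, by have := i.isLt; omega⟩)))
  simp only [MultilinearMap.mkPiAlgebraFin_apply] at this
  refine Eq.trans ?_ (this.trans (Finset.sum_congr rfl fun s _ => ?_))
  · refine congrArg (fun f : Fin k → Module.End ℝ V => (List.ofFn f).prod) ?_
    funext i
    simp only [Pi.add_apply, Q]
    abel
  · refine congrArg (fun f : Fin k → Module.End ℝ V => (List.ofFn f).prod) ?_
    funext i
    by_cases h : i ∈ s <;> simp [B, h]
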